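/- The graph A7 contains the wheel W_7 as an induced subgraph; consequently A7 is not 3-colourable and is not word-representable. -/

import Mathlib

/-- Two distinct letters `x` and `y` alternate in the word `w` if, after deleting all
letters other than `x` and `y` from `w`, no two consecutive letters of the resulting
word are equal (i.e. it reads `xyxy...` or `yxyx...`). -/
def Alternates {V : Type*} [DecidableEq V] (w : List V) (x y : V) : Prop :=
  List.Chain' (· ≠ ·) (w.filter fun z => z = x ∨ z = y)

/-- A finite simple graph `G = (V, E)` is word-representable if there is a word over the
alphabet `V` in which every element of `V` occurs at least once and such that, for all
distinct `x, y ∈ V`, the letters `x` and `y` alternate in the word iff `{x, y} ∈ E`. -/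
def WordRepresentable {V : Type*} [DecidableEq V] (G : SimpleGraph V) : Prop :=
  ∃ w : List V, (∀ v : V, v ∈ w) ∧
    ∀ x y : V, x ≠ y → (G.Adj x y ↔ Alternates w x y)

/-- The wheel graph `W_n` on `n + 1` vertices: a cycle on the `n` vertices `Sum.inl i`
(`i : Fin n`), together with one new hub vertex `Sum.inr ()` adjacent to all of them. -/
def wheelGraph (n : ℕ) : SimpleGraph (Fin n ⊕ Unit) :=
  SimpleGraph.fromRel fun a b =>
    match a, b with
    | Sum.inl i, Sum.inl j => ((i : ℕ) + 1) % n = (j : ℕ)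
    | Sum.inl _, Sum.inr _ => True
    | _, _ => False

/-- The simple graph on `V` whose edges are (the unordered versions of) the pairs
occurring in the list `l`. -/
def graphOfList {V : Type*} (l : List (V × V)) : SimpleGraph V :=
  SimpleGraph.fromRel fun a b => (a, b) ∈ l

def edgesA7 : List ((Fin 4 × Fin 3) × (Fin 4 × Fin 3)) :=
  [
    ((0, 0), (1, 0)), ((0, 0), (0, 1)), ((0, 1), (1, 1)), ((0, 1), (0, 2)), ((0, 2), (1, 2)),
    ((1, 0), (2, 0)), ((1, 0), (1, 1)), ((1, 1), (2, 1)), ((1, 1), (1, 2)), ((1, 2), (2, 2)),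
    ((2, 0), (2, 1)), ((2, 1), (3, 1)), ((2, 2), (3, 2)), ((3, 1), (3, 2)), ((0, 1), (1, 2)),
    ((0, 1), (1, 0)), ((1, 1), (2, 0)), ((1, 1), (2, 2)), ((1, 1), (3, 2)), ((2, 1), (3, 2))]

/-- The graph `A7` from the paper, with vertex set
`{(x,y) : 0 ≤ x ≤ 3, 0 ≤ y ≤ 2} \ {(3, 0)}`. -/
def graphA7 : SimpleGraph {p : Fin 4 × Fin 3 | p ≠ (3, 0)} :=
  (graphOfList edgesA7).induce {p : Fin 4 × Fin 3 | p ≠ (3, 0)}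

theorem chain_aux {V : Type*} [DecidableEq V] (x y : V) (hxy : x ≠ y) (w : List V) :
    (List.IsChain (· ≠ ·) (x :: w.filter fun z => z = x ∨ z = y) ↔
      ∀ t, (w.take t).count x ≤ (w.take t).count y ∧
        (w.take t).count y ≤ (w.take t).count x + 1) ∧
    (List.IsChain (· ≠ ·) (y :: w.filter fun z => z = x ∨ z = y) ↔
      ∀ t, (w.take t).count y ≤ (w.take t).count x ∧
        (w.take t).count x ≤ (w.take t).count y + 1) := by
  have key : ∀ P : ℕ → Prop, (∀ t, P t) ↔ P 0 ∧ ∀ t, P (t + 1) := by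
    intro P
    constructor
    · intro h; exact ⟨h 0, fun t => h _⟩
    · rintro ⟨h0, h1⟩ t
      cases t with
      | zero => exact h0
      | succ t => exact h1 t
  induction w with
  | nil => simp
  | cons z w ih =>
    obtain ⟨ih1, ih2⟩ := ih
    rw [key, key (fun t => (List.take t (z :: w)).count y ≤ _ ∧ _)]
    by_cases h1 : z = x
    · subst h1
      have e : (List.filter (fun a => decide (a = z ∨ a = y)) (z :: w)) =
          z :: List.filter (fun a => decide (a = z ∨ a = y)) w := by simp
      rw [e, List.isChain_cons_cons, List.isChain_cons_cons, ih1]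
      simp only [List.take_succ_cons, List.count_cons_self, List.count_cons_of_ne hxy,
        List.take_zero, List.count_nil]
      constructor
      · constructor
        · rintro ⟨h, -⟩; exact absurd rfl h
        · rintro ⟨-, h⟩; have := h 0; simp at this
      · constructor
        · rintro ⟨-, h⟩; exact ⟨by omega, fun t => by have := h t; omega⟩
        · rintro ⟨-, h⟩; exact ⟨hxy.symm, fun t => by have := h t; omega⟩
    · by_cases h2 : z = y
      · subst h2
        have e : (List.filter (fun a => decide (a = x ∨ a = z)) (z :: w)) =
            z :: List.filter (fun a => decide (a = x ∨ a = z)) w := by simp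
        rw [e, List.isChain_cons_cons, List.isChain_cons_cons, ih2]
        simp only [List.take_succ_cons, List.count_cons_self, List.count_cons_of_ne hxy.symm,
          List.take_zero, List.count_nil]
        constructor
        · constructor
          · rintro ⟨-, h⟩; exact ⟨by omega, fun t => by have := h t; omega⟩
          · rintro ⟨-, h⟩; exact ⟨hxy, fun t => by have := h t; omega⟩
        · constructor
          · rintro ⟨h, -⟩; exact absurd rfl h
          · rintro ⟨-, h⟩; have := h 0; simp at this
      · have e : (List.filter (fun a => decide (a = x ∨ a = y)) (z :: w)) =
            List.filter (fun a => decide (a = x ∨ a = y)) w := by simp [h1, h2]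
        rw [e, ih1, ih2]
        simp [List.take_succ_cons, List.count_cons_of_ne h1, List.count_cons_of_ne h2]

theorem alternates_iff {V : Type*} [DecidableEq V] (x y : V) (hxy : x ≠ y) (w : List V) :
    Alternates w x y ↔
      (∀ t, (w.take t).count x ≤ (w.take t).count y ∧
        (w.take t).count y ≤ (w.take t).count x + 1) ∨
      (∀ t, (w.take t).count y ≤ (w.take t).count x ∧
        (w.take t).count x ≤ (w.take t).count y + 1) := by
  obtain ⟨h1, h2⟩ := chain_aux x y hxy w
  rw [← h1, ← h2]
  have hm : ∀ a ∈ w.filter (fun z => z = x ∨ z = y), a = x ∨ a = y := by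
    intro a ha
    simpa using (List.mem_filter.1 ha).2
  change List.IsChain _ _ ↔ _
  generalize w.filter (fun z => z = x ∨ z = y) = l at hm ⊢
  cases l with
  | nil => simp
  | cons a l =>
    rw [List.isChain_cons_cons, List.isChain_cons_cons]
    rcases hm a (by simp) with rfl | rfl
    · simp [hxy.symm]
    · simp [hxy]

/-- shifted counting function, relative to the hub -/
noncomputable def shiftCount {V : Type*} [DecidableEq V] (w : List V) (h x : V) (t : ℕ) : ℕ :=
  open Classical in
  (w.take t).count x + if (∀ t, (w.take t).count x ≤ (w.take t).count h) then 1 else 0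

theorem alternates_iff_comparable {V : Type*} [DecidableEq V] (w : List V) (h x y : V)
    (hxh : x ≠ h) (hyh : y ≠ h) (hxy : x ≠ y)
    (ax : Alternates w x h) (ay : Alternates w y h) :
    Alternates w x y ↔ (∀ t, shiftCount w h y t ≤ shiftCount w h x t) ∨
      (∀ t, shiftCount w h x t ≤ shiftCount w h y t) := by
  rw [alternates_iff _ _ hxh] at ax
  rw [alternates_iff _ _ hyh] at ay
  rw [alternates_iff _ _ hxy]
  have bound : ∀ z, ((∀ t, (w.take t).count z ≤ (w.take t).count h ∧
        (w.take t).count h ≤ (w.take t).count z + 1) ∨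
      (∀ t, (w.take t).count h ≤ (w.take t).count z ∧
        (w.take t).count z ≤ (w.take t).count h + 1)) → ∀ t,
        (w.take t).count h ≤ shiftCount w h z t ∧
        shiftCount w h z t ≤ (w.take t).count h + 1 := by
    intro z hz t
    unfold shiftCount
    split_ifs with hc
    · have := hc t
      rcases hz with hz | hz <;> have := hz t <;> omega
    · rcases hz with hz | hz
      · exact absurd (fun t => (hz t).1) hc
      · have := hz t; omega
  have bx := bound x ax
  have b_y := bound y ay
  unfold shiftCount at *
  have c0 : ∀ z, (w.take 0).count z = 0 := by simp
  split_ifs at * with cx cy cy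
  · constructor
    · rintro (H | H)
      · right; intro t; have := H t; omega
      · left; intro t; have := H t; omega
    · rintro (H | H)
      · right; intro t; have := H t; have := bx t; have := b_y t; omega
      · left; intro t; have := H t; have := bx t; have := b_y t; omega
  · constructor
    · rintro (H | H)
      · right; intro t; have := H t; have := bx t; have := b_y t; omega
      · right; intro t; have := H t; omega
    · rintro (H | H)
      · have := H 0; simp at this
      · right; intro t; have := H t; have := bx t; have := b_y t; have := cx t; omega
  · constructor
    · rintro (H | H)
      · left; intro t; have := H t; omega
      · left; intro t; have := H t; have := bx t; have := b_y t; omega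
    · rintro (H | H)
      · left; intro t; have := H t; have := bx t; have := b_y t; have := cy t; omega
      · have := H 0; simp at this
  · constructor
    · rintro (H | H)
      · right; intro t; have := H t; omega
      · left; intro t; have := H t; omega
    · rintro (H | H)
      · right; intro t; have := H t; have := bx t; have := b_y t; omega
      · left; intro t; have := H t; have := bx t; have := b_y t; omega

/-- The 7-cycle has no transitive orientation. -/
theorem no_trans_seven (R : Fin 7 → Fin 7 → Prop)
    (tr : ∀ i j k, R i j → R j k → R i k)
    (e : ∀ i, R i (i + 1) ∨ R (i + 1) i)
    (ne : ∀ i, ¬ R i (i + 2) ∧ ¬ R (i + 2) i) : False := by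
  have up : ∀ i, R i (i + 1) → R (i + 2) (i + 1) := by
    intro i h
    have := e (i + 1)
    rw [add_assoc, show (1 + 1 : Fin 7) = 2 from rfl] at this
    rcases this with h' | h'
    · exact absurd (tr _ _ _ h h') (ne i).1
    · exact h'
  have dn : ∀ i, R (i + 1) i → R (i + 1) (i + 2) := by
    intro i h
    have := e (i + 1)
    rw [add_assoc, show (1 + 1 : Fin 7) = 2 from rfl] at this
    rcases this with h' | h'
    · exact h'
    · exact absurd (tr _ _ _ h' h) (ne i).2
  have no : ∀ i, R i (i + 1) → R (i + 1) i → False := by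
    intro i h h'
    have h2 := up i h
    exact (ne i).2 (tr _ _ _ h2 h')
  rcases e 0 with h | h
  · exact no 0 h (up 6 (dn 5 (up 4 (dn 3 (up 2 (dn 1 (up 0 h)))))))
  · exact no 0 (dn 6 (up 5 (dn 4 (up 3 (dn 2 (up 1 (dn 0 h))))))) h

def vtx (p : Fin 4 × Fin 3) (hp : p ≠ (3, 0)) : {p : Fin 4 × Fin 3 | p ≠ (3, 0)} := ⟨p, hp⟩

def rim (i : Fin 7) : {p : Fin 4 × Fin 3 | p ≠ (3, 0)} :=
  match i with
  | 0 => vtx (0, 1) (by decide)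
  | 1 => vtx (1, 0) (by decide)
  | 2 => vtx (2, 0) (by decide)
  | 3 => vtx (2, 1) (by decide)
  | 4 => vtx (3, 2) (by decide)
  | 5 => vtx (2, 2) (by decide)
  | 6 => vtx (1, 2) (by decide)

def hub : {p : Fin 4 × Fin 3 | p ≠ (3, 0)} := vtx (1, 1) (by decide)

theorem adj_iff (a b : {p : Fin 4 × Fin 3 | p ≠ (3, 0)}) :
    graphA7.Adj a b ↔ a.1 ≠ b.1 ∧ ((a.1, b.1) ∈ edgesA7 ∨ (b.1, a.1) ∈ edgesA7) := Iff.rfl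

theorem rim_adj (i j : Fin 7) : graphA7.Adj (rim i) (rim j) ↔ (i + 1 = j ∨ j + 1 = i) := by
  rw [adj_iff]; revert i j; decide

theorem rim_hub (i : Fin 7) : graphA7.Adj (rim i) hub := by
  rw [adj_iff]; revert i; decide

theorem rim_inj (i j : Fin 7) (h : rim i = rim j) : i = j := by
  have h' : (rim i).1 = (rim j).1 := by rw [h]
  clear h
  revert i j; decide

theorem not_wr : ¬ WordRepresentable graphA7 := by
  rintro ⟨w, -, hw⟩
  have hub_ne : ∀ i, rim i ≠ hub := fun i => (rim_hub i).ne
  have hub_alt : ∀ i, Alternates w (rim i) hub := fun i => (hw _ _ (hub_ne i)).1 (rim_hub i)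
  have main : ∀ i j, i ≠ j → ((i + 1 = j ∨ j + 1 = i) ↔
      (∀ t, shiftCount w hub (rim j) t ≤ shiftCount w hub (rim i) t) ∨
      (∀ t, shiftCount w hub (rim i) t ≤ shiftCount w hub (rim j) t)) := by
    intro i j hij
    have hne : rim i ≠ rim j := fun h => hij (rim_inj _ _ h)
    rw [← rim_adj, hw _ _ hne]
    exact alternates_iff_comparable w hub _ _ (hub_ne i) (hub_ne j) hne (hub_alt i) (hub_alt j)
  refine no_trans_seven
    (fun i j => ∀ t, shiftCount w hub (rim j) t ≤ shiftCount w hub (rim i) t) ?_ ?_ ?_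
  · intro i j k h1 h2 t
    exact (h2 t).trans (h1 t)
  · intro i
    exact (main i (i + 1) (by revert i; decide)).1 (Or.inl rfl)
  · intro i
    have h := main i (i + 2) (by revert i; decide)
    have h' : ¬ (i + 1 = i + 2 ∨ i + 2 + 1 = i) := by clear h; revert i; decide
    rw [h] at h'
    exact not_or.1 h'

theorem not_col : ¬ graphA7.Colorable 3 := by
  rintro ⟨c⟩
  have hc : ∀ i, c (rim i) ≠ c hub := fun i => c.valid (rim_hub i)
  have hr : ∀ i, c (rim i) ≠ c (rim (i + 1)) :=
    fun i => c.valid ((rim_adj _ _).2 (Or.inl rfl))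
  have step : ∀ i, c (rim (i + 2)) = c (rim i) := by
    intro i
    have h1 := hr i
    have h2 := hr (i + 1)
    rw [add_assoc, show (1 + 1 : Fin 7) = 2 from rfl] at h2
    have h3 := hc i
    have h4 := hc (i + 1)
    have h5 := hc (i + 2)
    omega
  have : c (rim 6) = c (rim 0) := (step 4).trans ((step 2).trans (step 0))
  exact hr 6 this

/-- The embedding of the wheel. -/
def wheelMap : Fin 7 ⊕ Unit → {p : Fin 4 × Fin 3 | p ≠ (3, 0)}
  | Sum.inl i => rim i
  | Sum.inr _ => hub

theorem emb : Nonempty (wheelGraph 7 ↪g graphA7) := by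
  refine ⟨⟨⟨wheelMap, ?_⟩, ?_⟩⟩
  · rintro (i | i) (j | j) h
    · exact congrArg _ (rim_inj _ _ h)
    · exact absurd h (rim_hub i).ne
    · exact absurd h.symm (rim_hub j).ne
    · rfl
  · rintro (i | i) (j | j)
    · change graphA7.Adj (rim i) (rim j) ↔ _
      rw [rim_adj]
      simp only [wheelGraph, SimpleGraph.fromRel_adj, ne_eq, Sum.inl.injEq]
      revert i j; decide
    · change graphA7.Adj (rim i) hub ↔ _
      simp [wheelGraph, rim_hub]
    · change graphA7.Adj hub (rim j) ↔ _
      simp [wheelGraph, (rim_hub j).symm]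
    · change graphA7.Adj hub hub ↔ _
      simp

/-- The graph `A7` contains the wheel `W_7` as an induced subgraph; consequently `A7`
is not 3-colourable and is not word-representable. -/
theorem graphA7_wheel7_not_colorable_not_wordRepresentable :
    Nonempty (wheelGraph 7 ↪g graphA7) ∧
      ¬ graphA7.Colorable 3 ∧ ¬ WordRepresentable graphA7 :=
  ⟨emb, not_col, not_wr⟩
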